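/- arXiv:2309.06601 — 5 statements merged into one kernel-verified Lean document; each statement's English description precedes it below -/
import Mathlib

section
/- Let Θ ⊆ ℝ be open and let f(·|θ) be, for each θ ∈ Θ, a strictly positive probability density on ℝ that is differentiable in θ and satisfies ∫ ∂f(x|θ)/∂θ dx = 0. Let X₁,…,Xₙ be i.i.d. with density f(·|θ), so the joint density is p(x|θ) = ∏_{j=1}^{n} f(x_j|θ). Let W : ℝⁿ → ℝ be measurable with g(θ) := ∫ W(x) p(x|θ) dx differentiable and g'(θ) = ∫ W(x) ∂p(x|θ)/∂θ dx, with Var_θ(W) < ∞, and assume 0 < I(θ) := ∫ (∂ log f(x|θ)/∂θ)² f(x|θ) dx < ∞. Then Var_θ(W) ≥ (g'(θ))² / (n · I(θ)). -/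
open MeasureTheory

/-- If `u² w` and `v² w` are integrable with `w ≥ 0`, then so is `u v w`. -/
lemma integrable_mul_of_integrable_sq_mul {α : Type*} [MeasurableSpace α] {μ : Measure α}
    {u v w : α → ℝ} (hu : AEStronglyMeasurable u μ) (hv : AEStronglyMeasurable v μ)
    (hw : AEStronglyMeasurable w μ) (hw0 : ∀ x, 0 ≤ w x)
    (huw : Integrable (fun x => u x ^ 2 * w x) μ) (hvw : Integrable (fun x => v x ^ 2 * w x) μ) :
    Integrable (fun x => u x * v x * w x) μ := by
  refine (huw.add hvw).mono ((hu.mul hv).mul hw) (.of_forall fun x => ?_)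
  have h0 := hw0 x
  have hsum : 0 ≤ (u x ^ 2 + v x ^ 2) * w x := by positivity
  simp only [Pi.add_apply, Real.norm_eq_abs]
  rw [← add_mul, abs_of_nonneg hsum, abs_mul, abs_mul, abs_of_nonneg h0]
  refine mul_le_mul_of_nonneg_right ?_ h0
  nlinarith [sq_nonneg (|u x| - |v x|), sq_abs (u x), sq_abs (v x), sq_nonneg (u x),
    sq_nonneg (v x)]

section IIDDensity

variable {ι : Type*} [Fintype ι] {q s : ℝ → ℝ}

lemma score_mul_prod_eq [DecidableEq ι] (i : ι) (x : ι → ℝ) :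
    s (x i) * ∏ k, q (x k) = ∏ k, (if k = i then s (x k) else 1) * q (x k) := by
  rw [Finset.prod_mul_distrib, Finset.prod_ite_eq' Finset.univ i (fun k => s (x k))]
  simp

lemma score_mul_score_mul_prod_eq [DecidableEq ι] (i j : ι) (x : ι → ℝ) :
    s (x i) * s (x j) * ∏ k, q (x k) =
      ∏ k, (if k = i then s (x k) else 1) * ((if k = j then s (x k) else 1) * q (x k)) := by
  rw [Finset.prod_mul_distrib, ← score_mul_prod_eq,
    Finset.prod_ite_eq' Finset.univ i (fun k => s (x k))]
  simp [mul_assoc]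

lemma integrable_score_mul_prod (hq : Integrable q) (hsq : Integrable fun y => s y * q y) (i : ι) :
    Integrable fun x : ι → ℝ => s (x i) * ∏ k, q (x k) := by
  classical
  simp_rw [score_mul_prod_eq]
  refine Integrable.fintype_prod (f := fun k y => (if k = i then s y else 1) * q y) fun k => ?_
  by_cases h : k = i <;> simpa [h]

lemma integral_score_mul_prod (hs : ∫ y, s y * q y = 0) (i : ι) :
    ∫ x : ι → ℝ, s (x i) * ∏ k, q (x k) = 0 := by
  classical
  simp_rw [score_mul_prod_eq]
  rw [integral_fintype_prod_volume_eq_prod (f := fun k y => (if k = i then s y else 1) * q y)]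
  exact Finset.prod_eq_zero (Finset.mem_univ i) (by simpa using hs)

lemma integrable_score_mul_score_mul_prod (hq : Integrable q)
    (hsq : Integrable fun y => s y * q y) (hssq : Integrable fun y => s y ^ 2 * q y) (i j : ι) :
    Integrable fun x : ι → ℝ => s (x i) * s (x j) * ∏ k, q (x k) := by
  classical
  simp_rw [score_mul_score_mul_prod_eq]
  refine Integrable.fintype_prod (f := fun k y =>
    (if k = i then s y else 1) * ((if k = j then s y else 1) * q y)) fun k => ?_
  split_ifs
  · simpa only [← mul_assoc, ← sq] using hssq
  all_goals simpa only [one_mul]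

lemma integral_score_mul_score_mul_prod [DecidableEq ι] (hq : ∫ y, q y = 1)
    (hs : ∫ y, s y * q y = 0) (i j : ι) :
    ∫ x : ι → ℝ, s (x i) * s (x j) * ∏ k, q (x k) =
      if i = j then ∫ y, s y ^ 2 * q y else 0 := by
  simp_rw [score_mul_score_mul_prod_eq]
  rw [integral_fintype_prod_volume_eq_prod (f := fun k y =>
    (if k = i then s y else 1) * ((if k = j then s y else 1) * q y))]
  split_ifs with h
  · subst h
    rw [Finset.prod_eq_single i (fun k _ hk => by simpa [hk] using hq) (by simp)]
    simp [sq, mul_assoc]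
  · exact Finset.prod_eq_zero (Finset.mem_univ i) (by simpa [h] using hs)

lemma sum_score_sq_mul_prod_eq (x : ι → ℝ) :
    (∑ i, s (x i)) ^ 2 * ∏ k, q (x k) = ∑ i, ∑ j, s (x i) * s (x j) * ∏ k, q (x k) := by
  simp_rw [sq, Finset.sum_mul_sum, Finset.sum_mul]

lemma integrable_sum_score_sq_mul_prod (hq : Integrable q)
    (hsq : Integrable fun y => s y * q y) (hssq : Integrable fun y => s y ^ 2 * q y) :
    Integrable fun x : ι → ℝ => (∑ i, s (x i)) ^ 2 * ∏ k, q (x k) := by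
  simp_rw [sum_score_sq_mul_prod_eq]
  exact integrable_finsetSum _ fun i _ => integrable_finsetSum _ fun j _ =>
    integrable_score_mul_score_mul_prod hq hsq hssq i j

/-- The Fisher information of an i.i.d. sample is the sample size times that of one observation. -/
lemma integral_sum_score_sq_mul_prod (hq : Integrable q) (hq1 : ∫ y, q y = 1)
    (hsq : Integrable fun y => s y * q y) (hs : ∫ y, s y * q y = 0)
    (hssq : Integrable fun y => s y ^ 2 * q y) :
    ∫ x : ι → ℝ, (∑ i, s (x i)) ^ 2 * ∏ k, q (x k) =
      Fintype.card ι * ∫ y, s y ^ 2 * q y := by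
  classical
  have hint := integrable_score_mul_score_mul_prod (ι := ι) hq hsq hssq
  simp_rw [sum_score_sq_mul_prod_eq]
  rw [integral_finsetSum _ fun i _ => integrable_finsetSum _ fun j _ => hint i j]
  simp_rw [integral_finsetSum _ fun j _ => hint _ j, integral_score_mul_score_mul_prod hq1 hs]
  simp

end IIDDensity

/-- The weighted covariance inequality underlying the Cramér–Rao bound. -/
lemma sq_integral_mul_div_le {α : Type*} [MeasurableSpace α] {μ : Measure α} {u v w : α → ℝ}
    (hw0 : ∀ x, 0 ≤ w x) (huw : Integrable (fun x => u x ^ 2 * w x) μ)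
    (hvw : Integrable (fun x => v x ^ 2 * w x) μ)
    (huvw : Integrable (fun x => u x * v x * w x) μ) (hv : 0 < ∫ x, v x ^ 2 * w x ∂μ) :
    (∫ x, u x * v x * w x ∂μ) ^ 2 / (∫ x, v x ^ 2 * w x ∂μ) ≤ ∫ x, u x ^ 2 * w x ∂μ := by
  set J := ∫ x, v x ^ 2 * w x ∂μ
  set C := ∫ x, u x * v x * w x ∂μ
  have hnonneg : 0 ≤ ∫ x, (u x - C / J * v x) ^ 2 * w x ∂μ :=
    integral_nonneg fun x => mul_nonneg (sq_nonneg _) (hw0 x)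
  have hexpand : ∫ x, (u x - C / J * v x) ^ 2 * w x ∂μ =
      (∫ x, u x ^ 2 * w x ∂μ) - 2 * (C / J) * C + (C / J) ^ 2 * J := by
    rw [← integral_const_mul, ← integral_const_mul, ← integral_sub huw (huvw.const_mul _),
      ← integral_add (by exact huw.sub (huvw.const_mul _)) (hvw.const_mul _)]
    congr 1 with x
    ring
  have hsimp : 2 * (C / J) * C - (C / J) ^ 2 * J = C ^ 2 / J := by
    field_simp
    ring
  linarith

/-- Cramér–Rao lower bound for i.i.d. observations: the Fisher information of the
sample is `n` times the Fisher information per observation. -/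
theorem cramer_rao_iid
    (Θ : Set ℝ) (hΘ : IsOpen Θ) (n : ℕ) (hn : 0 < n)
    (f f' : ℝ → ℝ → ℝ)
    (hf_meas : ∀ θ ∈ Θ, Measurable (fun x => f x θ))
    (hf'_meas : ∀ θ ∈ Θ, Measurable (fun x => f' x θ))
    (hf_pos : ∀ x : ℝ, ∀ θ ∈ Θ, 0 < f x θ)
    (hf_prob : ∀ θ ∈ Θ, ∫ x, f x θ = 1)
    (hf_deriv : ∀ x : ℝ, ∀ θ ∈ Θ, HasDerivAt (fun t => f x t) (f' x θ) θ)
    (hf_zero : ∀ θ ∈ Θ, ∫ x, f' x θ = 0)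
    (p p' : (Fin n → ℝ) → ℝ → ℝ)
    (hp : ∀ x θ, p x θ = ∏ j, f (x j) θ)
    (hp_deriv : ∀ x, ∀ θ ∈ Θ, HasDerivAt (fun t => p x t) (p' x θ) θ)
    (W : (Fin n → ℝ) → ℝ) (hW : Measurable W)
    (g g' : ℝ → ℝ)
    (hg : ∀ θ ∈ Θ, g θ = ∫ x, W x * p x θ)
    (hg_int : ∀ θ ∈ Θ, Integrable (fun x => W x * p x θ))
    (hg_deriv : ∀ θ ∈ Θ, HasDerivAt g (g' θ) θ)
    (hg' : ∀ θ ∈ Θ, g' θ = ∫ x, W x * p' x θ)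
    (hVar : ∀ θ ∈ Θ, Integrable (fun x => (W x - g θ) ^ 2 * p x θ))
    (I : ℝ → ℝ)
    (hI : ∀ θ ∈ Θ, I θ = ∫ x, (f' x θ / f x θ) ^ 2 * f x θ)
    (hI_int : ∀ θ ∈ Θ, Integrable (fun x => (f' x θ / f x θ) ^ 2 * f x θ))
    (hI_pos : ∀ θ ∈ Θ, 0 < I θ) :
    ∀ θ ∈ Θ, (g' θ) ^ 2 / (n * I θ) ≤ ∫ x, (W x - g θ) ^ 2 * p x θ := by
  intro θ hθ
  set q : ℝ → ℝ := fun y => f y θ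
  set s : ℝ → ℝ := fun y => f' y θ / f y θ
  have hqpos : ∀ y, 0 < q y := fun y => hf_pos y θ hθ
  have hq_meas : Measurable q := hf_meas θ hθ
  have hs_meas : Measurable s := (hf'_meas θ hθ).div hq_meas
  have hq1 : ∫ y, q y = 1 := hf_prob θ hθ
  have hq : Integrable q := .of_integral_ne_zero (by simp [hq1])
  have hsq_eq : (fun y => s y * q y) = fun y => f' y θ :=
    funext fun y => div_mul_cancel₀ _ (hqpos y).ne'
  have hs0 : ∫ y, s y * q y = 0 := by rw [hsq_eq]; exact hf_zero θ hθ
  have hssq : Integrable fun y => s y ^ 2 * q y := hI_int θ hθ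
  have hsq : Integrable fun y => s y * q y := by
    simpa using integrable_mul_of_integrable_sq_mul (v := fun _ => 1)
      hs_meas.aestronglyMeasurable aestronglyMeasurable_const hq_meas.aestronglyMeasurable
      (fun y => (hqpos y).le) hssq (by simpa using hq)
  have hp_eq : ∀ x, p x θ = ∏ k, q (x k) := fun x => hp x θ
  have hp'_eq : ∀ x, p' x θ = (∑ i, s (x i)) * p x θ := by
    intro x
    have hderiv : HasDerivAt (fun t => p x t)
        (∑ i, (∏ j ∈ Finset.univ.erase i, f (x j) θ) • f' (x i) θ) θ := by
      simp_rw [hp]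
      exact HasDerivAt.fun_finsetProd fun i _ => hf_deriv (x i) θ hθ
    rw [(hp_deriv x θ hθ).unique hderiv, Finset.sum_mul]
    refine Finset.sum_congr rfl fun i _ => ?_
    rw [hp_eq, ← Finset.mul_prod_erase _ _ (Finset.mem_univ i), ← mul_assoc,
      congrFun hsq_eq (x i), smul_eq_mul, mul_comm]
  have hS2 : Integrable fun x : Fin n → ℝ => (∑ i, s (x i)) ^ 2 * p x θ := by
    simp_rw [hp_eq]
    exact integrable_sum_score_sq_mul_prod hq hsq hssq
  have hJ : ∫ x : Fin n → ℝ, (∑ i, s (x i)) ^ 2 * p x θ = n * I θ := by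
    simp_rw [hp_eq]
    rw [integral_sum_score_sq_mul_prod hq hq1 hsq hs0 hssq, hI θ hθ, Fintype.card_fin]
  have hS : Integrable fun x : Fin n → ℝ => (∑ i, s (x i)) * p x θ := by
    simp_rw [hp_eq, Finset.sum_mul]
    exact integrable_finsetSum _ fun i _ => integrable_score_mul_prod hq hsq i
  have hS0 : ∫ x : Fin n → ℝ, (∑ i, s (x i)) * p x θ = 0 := by
    simp_rw [hp_eq, Finset.sum_mul]
    rw [integral_finsetSum _ fun i _ => integrable_score_mul_prod hq hsq i]
    exact Finset.sum_eq_zero fun i _ => integral_score_mul_prod hs0 i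
  have hp0 : ∀ x, 0 ≤ p x θ := fun x => by
    rw [hp_eq]
    exact Finset.prod_nonneg fun k _ => (hqpos _).le
  have hp_meas : Measurable fun x => p x θ := by
    simp_rw [hp_eq]
    fun_prop
  have hS_meas : Measurable fun x : Fin n → ℝ => ∑ i, s (x i) := by fun_prop
  have hWS : Integrable fun x => (W x - g θ) * (∑ i, s (x i)) * p x θ :=
    integrable_mul_of_integrable_sq_mul (hW.sub_const _).aestronglyMeasurable
      hS_meas.aestronglyMeasurable hp_meas.aestronglyMeasurable hp0 (hVar θ hθ) hS2
  have hC : ∫ x, (W x - g θ) * (∑ i, s (x i)) * p x θ = g' θ := by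
    have hsplit : ∀ x, W x * p' x θ =
        (W x - g θ) * (∑ i, s (x i)) * p x θ + g θ * ((∑ i, s (x i)) * p x θ) := by
      intro x
      rw [hp'_eq]
      ring
    simp_rw [hg' θ hθ, hsplit]
    rw [integral_add hWS (hS.const_mul _), integral_const_mul, hS0, mul_zero, add_zero]
  have hJpos : 0 < ∫ x : Fin n → ℝ, (∑ i, s (x i)) ^ 2 * p x θ := by
    rw [hJ]
    exact mul_pos (Nat.cast_pos.mpr hn) (hI_pos θ hθ)
  simpa only [hC, hJ] using sq_integral_mul_div_le hp0 (hVar θ hθ) hS2 hWS hJpos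
end

section
/- Let J be a nonempty finite set, A > 0 a real constant, and B : J → ℝ arbitrary. For discrete probability distributions q on J define the quadratic score u(q, j) := A(2 q_j − Σ_{i∈J} q_i²) + B_j. Then for every strictly positive probability distribution p on J and every probability distribution q on J one has Σ_{j∈J} u(q, j) p_j ≤ Σ_{j∈J} u(p, j) p_j, with equality if and only if q = p. In other words, the quadratic score function is proper. -/
/-- The expected quadratic score under weights `p` of total mass one, with the square completed. -/
theorem expected_quadratic_score_eq {J : Type*} [Fintype J] (A : ℝ) (B p r : J → ℝ)
    (hp_sum : ∑ j, p j = 1) :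
    ∑ j, (A * (2 * r j - ∑ i, (r i) ^ 2) + B j) * p j
      = A * ∑ j, (p j) ^ 2 + ∑ j, B j * p j - A * ∑ j, (r j - p j) ^ 2 := by
  have score : ∑ j, (A * (2 * r j - ∑ i, (r i) ^ 2) + B j) * p j
      = 2 * A * ∑ j, r j * p j - A * (∑ i, (r i) ^ 2) * ∑ j, p j + ∑ j, B j * p j := by
    simp only [Finset.mul_sum (f := fun j => r j * p j), Finset.mul_sum (f := p),
      ← Finset.sum_sub_distrib, ← Finset.sum_add_distrib]
    exact Finset.sum_congr rfl fun j _ => by ring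
  have dist : ∑ j, (r j - p j) ^ 2
      = ∑ j, (r j) ^ 2 - 2 * ∑ j, r j * p j + ∑ j, (p j) ^ 2 := by
    rw [Finset.mul_sum, ← Finset.sum_sub_distrib, ← Finset.sum_add_distrib]
    exact Finset.sum_congr rfl fun j _ => by ring
  rw [score, dist, hp_sum]
  ring

/-- The quadratic score function `u(q,j) = A(2qⱼ − Σᵢ qᵢ²) + Bⱼ` is proper:
the expected score under any strictly positive distribution `p` is maximized
over distributions `q` exactly at `q = p`. -/
theorem quadratic_score_proper
    (J : Type*) [Fintype J] [Nonempty J]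
    (A : ℝ) (hA : 0 < A) (B : J → ℝ)
    (p q : J → ℝ)
    (hp_pos : ∀ j, 0 < p j) (hp_sum : ∑ j, p j = 1)
    (hq_nonneg : ∀ j, 0 ≤ q j) (hq_sum : ∑ j, q j = 1) :
    (∑ j, (A * (2 * q j - ∑ i, (q i) ^ 2) + B j) * p j)
      ≤ (∑ j, (A * (2 * p j - ∑ i, (p i) ^ 2) + B j) * p j)
    ∧ ((∑ j, (A * (2 * q j - ∑ i, (q i) ^ 2) + B j) * p j)
        = (∑ j, (A * (2 * p j - ∑ i, (p i) ^ 2) + B j) * p j) ↔ q = p) := by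
  have dist_nonneg : 0 ≤ ∑ j, (q j - p j) ^ 2 := Finset.sum_nonneg fun j _ => sq_nonneg _
  have dist_eq_zero : ∑ j, (q j - p j) ^ 2 = 0 ↔ q = p := by
    rw [Finset.sum_eq_zero_iff_of_nonneg fun j _ => sq_nonneg _]
    simp [sub_eq_zero, funext_iff]
  rw [expected_quadratic_score_eq A B p q hp_sum, expected_quadratic_score_eq A B p p hp_sum,
    ← dist_eq_zero]
  simp [hA.ne', mul_nonneg hA.le dist_nonneg]
end

section
/- Let J be a finite set with more than two elements. For each j ∈ J let u_j : (0,1] → ℝ be continuously differentiable, and suppose the local score function u(q, j) := u_j(q_j) is proper: for every strictly positive probability distribution p on J and every strictly positive probability distribution q on J, Σ_{j∈J} u_j(q_j) p_j ≤ Σ_{j∈J} u_j(p_j) p_j, with equality only if q = p. Then there exist a constant A > 0 and constants B_j ∈ ℝ (j ∈ J) such that u_j(x) = A log x + B_j for all x ∈ (0,1] and all j ∈ J. -/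
open Filter Topology

/-- A strictly positive distribution with prescribed values at two points of an index set
with more than two elements. -/
lemma exists_pos_distribution {J : Type*} [Fintype J] (hcard : 2 < Fintype.card J)
    {i j : J} (hij : i ≠ j) {x y : ℝ} (hx : 0 < x) (hy : 0 < y) (hxy : x + y < 1) :
    ∃ p : J → ℝ, (∀ k, 0 < p k) ∧ ∑ k, p k = 1 ∧ p i = x ∧ p j = y := by
  classical
  have hc : (0 : ℝ) < Fintype.card J - 2 := by
    have : (2 : ℝ) < Fintype.card J := by exact_mod_cast hcard
    linarith
  set r : ℝ := (1 - x - y) / (Fintype.card J - 2)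
  have hr0 : 0 < r := div_pos (by linarith) hc
  refine ⟨fun k => if k = i then x else if k = j then y else r, fun k => ?_, ?_, by simp,
    by simp [hij.symm]⟩
  · dsimp only
    split_ifs <;> assumption
  · have h : ∀ k, (if k = i then x else if k = j then y else r)
        = r + (if k = i then x - r else 0) + (if k = j then y - r else 0) := by
      intro k
      by_cases hki : k = i
      · subst hki; simp [hij]
      · by_cases hkj : k = j <;> simp [hki, hkj, hij.symm]
    have hmul : (Fintype.card J - 2) * r = 1 - x - y := mul_div_cancel₀ _ hc.ne'
    simp only [h, Finset.sum_add_distrib, Finset.sum_ite_eq', Finset.mem_univ, if_true,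
      Finset.sum_const, Finset.card_univ, nsmul_eq_mul]
    linarith

/-- Stationarity of the expected local score at the true distribution. -/
lemma mul_deriv_eq_mul_deriv_of_proper {J : Type*} [Fintype J] {u : J → ℝ → ℝ} {p : J → ℝ}
    (hd : ∀ k, DifferentiableAt ℝ (u k) (p k)) (hp : ∀ k, 0 < p k) (hp1 : ∑ k, p k = 1)
    (hmax : ∀ q : J → ℝ, (∀ k, 0 < q k) → ∑ k, q k = 1 →
      ∑ k, u k (q k) * p k ≤ ∑ k, u k (p k) * p k) (i j : J) :
    p i * deriv (u i) (p i) = p j * deriv (u j) (p j) := by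
  classical
  set c : J → ℝ := fun k => (if k = i then 1 else 0) - (if k = j then 1 else 0) with hc
  have hder : HasDerivAt (fun t : ℝ => ∑ k, u k (p k + t * c k) * p k)
      (∑ k, deriv (u k) (p k) * c k * p k) 0 := by
    refine HasDerivAt.fun_sum fun k _ => HasDerivAt.mul_const ?_ _
    have hline : HasDerivAt (fun t : ℝ => p k + t * c k) (c k) 0 := by
      simpa using ((hasDerivAt_id (0 : ℝ)).mul_const (c k)).const_add (p k)
    exact HasDerivAt.comp (h₂ := u k) 0 (by simpa using (hd k).hasDerivAt) hline
  have hlocal : IsLocalMax (fun t : ℝ => ∑ k, u k (p k + t * c k) * p k) 0 := by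
    have hpos : ∀ᶠ t : ℝ in 𝓝 0, ∀ k, 0 < p k + t * c k := by
      refine eventually_all.2 fun k => ?_
      have hcont : Continuous fun t : ℝ => p k + t * c k := by fun_prop
      exact hcont.continuousAt.eventually (lt_mem_nhds (by simpa using hp k))
    filter_upwards [hpos] with t ht
    simpa using hmax _ ht (by simp [Finset.sum_add_distrib, ← Finset.mul_sum, hc, hp1])
  have hzero := hlocal.hasDerivAt_eq_zero hder
  simp [hc, mul_sub, sub_mul, Finset.sum_sub_distrib] at hzero
  linarith

/-- A function on `(0, 1]` whose derivative is `A / x` is `A log` up to a constant. -/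
lemma eq_mul_log_add_of_mul_deriv_eq {f : ℝ → ℝ} {A : ℝ}
    (hf : ContinuousOn f (Set.Ioc 0 1)) (hd : ∀ x ∈ Set.Ioo (0 : ℝ) 1, DifferentiableAt ℝ f x)
    (hA : ∀ x ∈ Set.Ioo (0 : ℝ) 1, x * deriv f x = A) {x : ℝ} (hx : x ∈ Set.Ioc (0 : ℝ) 1) :
    f x = A * Real.log x + f 1 := by
  have hcont : ContinuousOn (fun y => f y - A * Real.log y) (Set.Icc x 1) := by
    refine (hf.mono fun y hy => ⟨hx.1.trans_le hy.1, hy.2⟩).sub (continuousOn_const.mul ?_)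
    exact Real.continuousOn_log.mono fun y hy => (hx.1.trans_le hy.1).ne'
  have hder : ∀ y ∈ Set.Ioo x 1, HasDerivAt (fun y => f y - A * Real.log y) 0 y := by
    intro y hy
    have hy0 : 0 < y := hx.1.trans hy.1
    have h := (hd y ⟨hy0, hy.2⟩).hasDerivAt.sub ((Real.hasDerivAt_log hy0.ne').const_mul A)
    have hzero : deriv f y - A * y⁻¹ = 0 := by
      rw [← hA y ⟨hy0, hy.2⟩, mul_right_comm, mul_inv_cancel₀ hy0.ne', one_mul, sub_self]
    rwa [hzero] at h
  rcases hx.2.eq_or_lt with rfl | hx1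
  · simp
  · obtain ⟨y, -, hy⟩ := exists_hasDerivAt_eq_slope _ (fun _ => 0) hx1 hcont hder
    have hne : (1 : ℝ) - x ≠ 0 := (sub_pos.2 hx1).ne'
    rw [eq_comm, div_eq_zero_iff, or_iff_left hne, Real.log_one] at hy
    linarith

/-- Characterization of smooth, proper, local score functions on a partition with
more than two elements: they must be logarithmic, `uⱼ(x) = A log x + Bⱼ` with `A > 0`. -/
theorem smooth_proper_local_score_is_logarithmic
    (J : Type*) [Fintype J] (hcard : 2 < Fintype.card J)
    (u : J → ℝ → ℝ)
    (hu_smooth : ∀ j, ContDiffOn ℝ 1 (u j) (Set.Ioc (0 : ℝ) 1))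
    (hproper : ∀ p q : J → ℝ,
        (∀ j, 0 < p j) → (∑ j, p j) = 1 →
        (∀ j, 0 < q j) → (∑ j, q j) = 1 →
        (∑ j, u j (q j) * p j) ≤ (∑ j, u j (p j) * p j)
        ∧ ((∑ j, u j (q j) * p j) = (∑ j, u j (p j) * p j) → q = p)) :
    ∃ A : ℝ, 0 < A ∧ ∃ B : J → ℝ, ∀ j, ∀ x ∈ Set.Ioc (0 : ℝ) 1,
      u j x = A * Real.log x + B j := by
  have hlt : ∀ p : J → ℝ, (∀ k, 0 < p k) → ∑ k, p k = 1 → ∀ k, p k < 1 := by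
    intro p hp hp1 k
    obtain ⟨l, hl⟩ := Fintype.exists_ne_of_one_lt_card (by omega) k
    rw [← hp1]
    exact Finset.single_lt_sum hl (Finset.mem_univ k) (Finset.mem_univ l) (hp l)
      fun m _ _ => (hp m).le
  have hdiff : ∀ j, ∀ x ∈ Set.Ioo (0 : ℝ) 1, DifferentiableAt ℝ (u j) x := fun j x hx =>
    ((hu_smooth j).differentiableOn one_ne_zero).differentiableAt (Ioc_mem_nhds hx.1 hx.2)
  have hpair : ∀ i j, i ≠ j → ∀ x y : ℝ, 0 < x → 0 < y → x + y < 1 →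
      x * deriv (u i) x = y * deriv (u j) y := by
    intro i j hij x y hx hy hxy
    obtain ⟨p, hp, hp1, rfl, rfl⟩ := exists_pos_distribution hcard hij hx hy hxy
    exact mul_deriv_eq_mul_deriv_of_proper (fun k => hdiff k _ ⟨hp k, hlt p hp hp1 k⟩) hp hp1
      (fun q hq hq1 => (hproper p q hp hp1 hq hq1).1) i j
  obtain ⟨a, b, hab⟩ := Fintype.exists_pair_of_one_lt_card (α := J) (by omega)
  set A : ℝ := 1 / 4 * deriv (u a) (1 / 4)
  have hconst : ∀ j, ∀ x ∈ Set.Ioo (0 : ℝ) 1, x * deriv (u j) x = A := by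
    intro j x hx
    have hx0 := hx.1
    have hx1 := hx.2
    have hsmall : ∀ k, k ≠ a → ∀ y : ℝ, 0 < y → y < 3 / 4 → y * deriv (u k) y = A :=
      fun k hk y hy hy' => hpair k a hk y (1 / 4) hy (by norm_num) (by linarith)
    by_cases hj : j = a
    · subst hj
      rw [hpair j b hab x ((1 - x) / 2) hx0 (by linarith) (by linarith)]
      exact hsmall b hab.symm _ (by linarith) (by linarith)
    · have hpos : (0 : ℝ) < (1 - x) / 4 := by linarith
      rw [hpair j a hj x ((1 - x) / 4) hx0 hpos (by linarith),
        hpair a b hab ((1 - x) / 4) (1 / 4) hpos (by norm_num) (by linarith)]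
      exact hsmall b hab.symm _ (by norm_num) (by norm_num)
  have hlog : ∀ j, ∀ x ∈ Set.Ioc (0 : ℝ) 1, u j x = A * Real.log x + u j 1 := fun j x hx =>
    eq_mul_log_add_of_mul_deriv_eq (hu_smooth j).continuousOn (hdiff j) (hconst j) hx
  refine ⟨A, ?_, fun j => u j 1, hlog⟩
  obtain ⟨p, hp, hp1, hpa, -⟩ := exists_pos_distribution hcard hab
    (x := 1 / 2) (y := 1 / 4) (by norm_num) (by norm_num) (by norm_num)
  obtain ⟨q, hq, hq1, hqa, -⟩ := exists_pos_distribution hcard hab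
    (x := 1 / 4) (y := 1 / 4) (by norm_num) (by norm_num) (by norm_num)
  have hne : q ≠ p := by
    rintro rfl
    norm_num [hpa] at hqa
  have hpq := hproper p q hp hp1 hq hq1
  have hpq_lt := lt_of_le_of_ne hpq.1 fun h => hne (hpq.2 h)
  have hqp := (hproper q p hq hq1 hp hp1).1
  have hsum : ∑ k, u k (p k) * p k - ∑ k, u k (q k) * p k
      + (∑ k, u k (q k) * q k - ∑ k, u k (p k) * q k)
      = A * ∑ k, (Real.log (p k) - Real.log (q k)) * (p k - q k) := by
    rw [← Finset.sum_sub_distrib, ← Finset.sum_sub_distrib, ← Finset.sum_add_distrib,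
      Finset.mul_sum]
    refine Finset.sum_congr rfl fun k _ => ?_
    rw [hlog k (p k) ⟨hp k, (hlt p hp hp1 k).le⟩, hlog k (q k) ⟨hq k, (hlt q hq hq1 k).le⟩]
    ring
  have hnonneg : 0 ≤ ∑ k, (Real.log (p k) - Real.log (q k)) * (p k - q k) := by
    refine Finset.sum_nonneg fun k _ => ?_
    rcases le_total (p k) (q k) with h | h
    · exact mul_nonneg_of_nonpos_of_nonpos (sub_nonpos.2 (Real.log_le_log (hp k) h))
        (sub_nonpos.2 h)
    · exact mul_nonneg (sub_nonneg.2 (Real.log_le_log (hq k) h)) (sub_nonneg.2 h)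
  exact pos_of_mul_pos_left (by linarith) hnonneg
end

section
/- Let A be a nonempty finite set of actions, I a nonempty finite set indexing possible experimental data, and J a nonempty finite set indexing relevant events. Let u : A × J → ℝ be the terminal utility, c : I → ℝ with c_i ≥ 0 the cost of obtaining data i, π : I → ℝ a probability distribution on I (the probabilities P(D_i|e)), for each i ∈ I let ρ_i : J → ℝ be a probability distribution on J (the posteriors P(E_j|e, D_i)), and let the prior p : J → ℝ be given by the law of total probability p_j = Σ_{i∈I} ρ_i(j) π_i. Let a₀* ∈ A maximize a ↦ Σ_{j∈J} u(a, j) p_j, and for each i ∈ I let a_i* ∈ A maximize a ↦ Σ_{j∈J} u(a, j) ρ_i(j). Define the expected value of the experiment v(e) := Σ_{i∈I} ( Σ_{j∈J} ( u(a_i*, j) − c_i − u(a₀*, j) ) ρ_i(j) ) π_i, the opportunity loss l(a, j) := (max_{a'∈A} u(a', j)) − u(a, j), the expected value of perfect information v*(e₀) := Σ_{j∈J} l(a₀*, j) p_j, and the expected cost c̄(e) := Σ_{i∈I} c_i π_i. Then v(e) ≤ v*(e₀) − c̄(e). -/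
/-- The expected value `v(e)` of an experiment is bounded above by the expected
value of perfect information minus the expected cost: `v(e) ≤ v*(e₀) − c̄(e)`. -/
theorem expected_value_of_experiment_le
    (A I J : Type*) [Fintype A] [Nonempty A] [Fintype I] [Nonempty I]
    [Fintype J] [Nonempty J]
    (u : A → J → ℝ) (c : I → ℝ) (hc : ∀ i, 0 ≤ c i)
    (π : I → ℝ) (hπ_nonneg : ∀ i, 0 ≤ π i) (hπ_sum : ∑ i, π i = 1)
    (ρ : I → J → ℝ) (hρ_nonneg : ∀ i j, 0 ≤ ρ i j) (hρ_sum : ∀ i, ∑ j, ρ i j = 1)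
    (p : J → ℝ) (hp : ∀ j, p j = ∑ i, ρ i j * π i)
    (a₀ : A) (ha₀ : ∀ a, ∑ j, u a j * p j ≤ ∑ j, u a₀ j * p j)
    (astar : I → A) (hastar : ∀ i a, ∑ j, u a j * ρ i j ≤ ∑ j, u (astar i) j * ρ i j) :
    (∑ i, (∑ j, (u (astar i) j - c i - u a₀ j) * ρ i j) * π i)
      ≤ (∑ j, ((Finset.univ.sup' Finset.univ_nonempty fun a => u a j) - u a₀ j) * p j)
        - ∑ i, c i * π i := by
  have swap : ∑ j, ((Finset.univ.sup' Finset.univ_nonempty fun a => u a j) - u a₀ j) * p j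
      = ∑ i, (∑ j, ((Finset.univ.sup' Finset.univ_nonempty fun a => u a j) - u a₀ j) * ρ i j)
          * π i := by
    simp only [hp, Finset.mul_sum, Finset.sum_mul, mul_assoc]
    exact Finset.sum_comm
  rw [swap, ← Finset.sum_sub_distrib]
  refine Finset.sum_le_sum fun i _ => ?_
  rw [← sub_mul]
  refine mul_le_mul_of_nonneg_right ?_ (hπ_nonneg i)
  have cost : c i = ∑ j, c i * ρ i j := by rw [← Finset.mul_sum, hρ_sum, mul_one]
  conv_rhs => rw [cost]
  rw [← Finset.sum_sub_distrib]
  refine Finset.sum_le_sum fun j _ => ?_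
  rw [← sub_mul]
  refine mul_le_mul_of_nonneg_right ?_ (hρ_nonneg i j)
  have le_sup := Finset.le_sup' (fun a => u a j) (Finset.mem_univ (astar i))
  linarith
end

section
/- Let (Θ, F, μ) be a σ-finite measure space, A > 0 a constant, and B : Θ → ℝ measurable. For probability densities q with respect to μ (q ≥ 0 measurable, ∫ q dμ = 1) that are square-integrable, define the quadratic score u(q, θ) := A(2 q(θ) − ∫_Θ q² dμ) + B(θ). Then for any two square-integrable probability densities p and q with respect to μ such that B·p is μ-integrable, ∫_Θ u(q, θ) p(θ) dμ(θ) ≤ ∫_Θ u(p, θ) p(θ) dμ(θ), with equality if and only if q = p μ-almost everywhere. In other words, the quadratic score function is proper in the continuous case. -/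
open MeasureTheory

/-- The expected quadratic score of a report `r` under the density `p`, with `c` standing for
the value of `∫ r² dμ`. -/
theorem integral_quadratic_score_mul {Θ : Type*} [MeasurableSpace Θ] {μ : Measure Θ}
    (A c : ℝ) {B p r : Θ → ℝ} (hp_int : Integrable p μ) (hp_one : ∫ θ, p θ ∂μ = 1)
    (hrp : Integrable (fun θ => r θ * p θ) μ) (hBp : Integrable (fun θ => B θ * p θ) μ) :
    ∫ θ, (A * (2 * r θ - c) + B θ) * p θ ∂μ
      = A * (2 * ∫ θ, r θ * p θ ∂μ - c) + ∫ θ, B θ * p θ ∂μ := by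
  have hscore : ∀ θ, (A * (2 * r θ - c) + B θ) * p θ
      = (2 * A) * (r θ * p θ) - (A * c) * p θ + B θ * p θ := fun θ => by ring
  simp_rw [hscore]
  rw [integral_add (by exact (hrp.const_mul _).sub (hp_int.const_mul _)) hBp,
    integral_sub (hrp.const_mul _) (hp_int.const_mul _), integral_const_mul,
    integral_const_mul, hp_one]
  ring

/-- The `L²` distance between two square-integrable functions vanishes exactly when they agree
almost everywhere. -/
theorem integral_sub_sq_eq_zero_iff {Θ : Type*} [MeasurableSpace Θ] {μ : Measure Θ}
    {p q : Θ → ℝ} (h : Integrable (fun θ => (p θ - q θ) ^ 2) μ) :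
    ∫ θ, (p θ - q θ) ^ 2 ∂μ = 0 ↔ q =ᵐ[μ] p := by
  rw [integral_eq_zero_iff_of_nonneg (fun θ => sq_nonneg (p θ - q θ)) h]
  refine Filter.eventually_congr (Filter.Eventually.of_forall fun θ => ?_)
  simp [sub_eq_zero, eq_comm]

/-- The quadratic score function `u(q,θ) = A(2q(θ) − ∫ q² dμ) + B(θ)` is proper
in the continuous case: the expected score under a density `p` is maximized over
densities `q` exactly when `q = p` almost everywhere. -/
theorem quadratic_score_proper_continuous
    {Θ : Type*} [MeasurableSpace Θ] (μ : Measure Θ) [SigmaFinite μ]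
    (A : ℝ) (hA : 0 < A) (B : Θ → ℝ) (hB : Measurable B)
    (p q : Θ → ℝ) (hp_meas : Measurable p) (hq_meas : Measurable q)
    (hp_nonneg : ∀ θ, 0 ≤ p θ) (hq_nonneg : ∀ θ, 0 ≤ q θ)
    (hp_int : Integrable p μ) (hq_int : Integrable q μ)
    (hp_one : ∫ θ, p θ ∂μ = 1) (hq_one : ∫ θ, q θ ∂μ = 1)
    (hp_sq : Integrable (fun θ => (p θ) ^ 2) μ)
    (hq_sq : Integrable (fun θ => (q θ) ^ 2) μ)
    (hBp : Integrable (fun θ => B θ * p θ) μ) :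
    (∫ θ, (A * (2 * q θ - ∫ t, (q t) ^ 2 ∂μ) + B θ) * p θ ∂μ)
      ≤ (∫ θ, (A * (2 * p θ - ∫ t, (p t) ^ 2 ∂μ) + B θ) * p θ ∂μ)
    ∧ ((∫ θ, (A * (2 * q θ - ∫ t, (q t) ^ 2 ∂μ) + B θ) * p θ ∂μ)
        = (∫ θ, (A * (2 * p θ - ∫ t, (p t) ^ 2 ∂μ) + B θ) * p θ ∂μ)
      ↔ q =ᵐ[μ] p) := by
  have hp_L2 : MemLp p 2 μ := (memLp_two_iff_integrable_sq hp_meas.aestronglyMeasurable).2 hp_sq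
  have hq_L2 : MemLp q 2 μ := (memLp_two_iff_integrable_sq hq_meas.aestronglyMeasurable).2 hq_sq
  have hqp : Integrable (fun θ => q θ * p θ) μ := hq_L2.integrable_mul hp_L2
  have hpp : Integrable (fun θ => p θ * p θ) μ := hp_L2.integrable_mul hp_L2
  have hdist : Integrable (fun θ => (p θ - q θ) ^ 2) μ := (hp_L2.sub hq_L2).integrable_sq
  have hexpand : ∫ θ, (p θ - q θ) ^ 2 ∂μ
      = ∫ θ, (p θ) ^ 2 ∂μ - 2 * ∫ θ, q θ * p θ ∂μ + ∫ θ, (q θ) ^ 2 ∂μ := by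
    have hsq : ∀ θ, (p θ - q θ) ^ 2 = (p θ) ^ 2 - 2 * (q θ * p θ) + (q θ) ^ 2 :=
      fun θ => by ring
    simp_rw [hsq]
    rw [integral_add (by exact hp_sq.sub (hqp.const_mul _)) hq_sq,
      integral_sub hp_sq (hqp.const_mul _), integral_const_mul]
  have hgap : (∫ θ, (A * (2 * p θ - ∫ t, (p t) ^ 2 ∂μ) + B θ) * p θ ∂μ)
      - (∫ θ, (A * (2 * q θ - ∫ t, (q t) ^ 2 ∂μ) + B θ) * p θ ∂μ)
      = A * ∫ θ, (p θ - q θ) ^ 2 ∂μ := by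
    rw [integral_quadratic_score_mul A _ hp_int hp_one hpp hBp,
      integral_quadratic_score_mul A _ hp_int hp_one hqp hBp, hexpand]
    simp_rw [← pow_two]
    ring
  constructor
  · rw [← sub_nonneg, hgap]
    exact mul_nonneg hA.le (integral_nonneg fun θ => sq_nonneg _)
  · rw [eq_comm, ← sub_eq_zero, hgap, mul_eq_zero, or_iff_right hA.ne',
      integral_sub_sq_eq_zero_iff hdist]
end
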